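/- arXiv:1207.1824 — 2 statements merged into one kernel-verified Lean document; each statement's English description precedes it below -/
import Mathlib

section
/- For every non-trivial two-coloring C of ℤ^d with min-width k and sensitivity s(C) = s, it holds that s ≥ (1/e²) · d^{1/k}. -/
open Function

section Lattice

variable {ι : Type*} [Fintype ι] [DecidableEq ι]

/-- A two-coloring of the lattice `ℤ^ι`: `false` = red, `true` = blue. -/
def sensAt (C : (ι → ℤ) → Bool) (x : ι → ℤ) : ℕ :=
  (Finset.univ.filter fun p : ι × Bool =>
    C (Function.update x p.1 (x p.1 + if p.2 then 1 else -1)) ≠ C x).card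

/-- The axis-sensitivity of `C` at the point `x`: the number of coordinate
directions along which some neighbor of `x` has a different color. -/
def axisSensAt (C : (ι → ℤ) → Bool) (x : ι → ℤ) : ℕ :=
  (Finset.univ.filter fun i : ι =>
    C (Function.update x i (x i + 1)) ≠ C x ∨
      C (Function.update x i (x i - 1)) ≠ C x).card

/-- The sensitivity `s(C)` of a coloring: the maximum of `s(C,x)` over all `x`. -/
noncomputable def sensSup (C : (ι → ℤ) → Bool) : ℕ := sSup (Set.range (sensAt C))

/-- The axis-sensitivity `r(C)` of a coloring: the maximum of `r(C,x)` over all `x`. -/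
noncomputable def axisSensSup (C : (ι → ℤ) → Bool) : ℕ := sSup (Set.range (axisSensAt C))

/-- The red sensitivity `s^R(C)`: maximum axis-sensitivity over red points. -/
noncomputable def redSens (C : (ι → ℤ) → Bool) : ℕ := sSup (axisSensAt C '' {x | C x = false})

/-- The blue sensitivity `s^B(C)`: maximum axis-sensitivity over blue points. -/
noncomputable def blueSens (C : (ι → ℤ) → Bool) : ℕ := sSup (axisSensAt C '' {x | C x = true})

/-- A coloring is non-trivial if the origin is red and each axis carries a blue point. -/
def NontrivialColoring (C : (ι → ℤ) → Bool) : Prop :=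
  C (fun _ => 0) = false ∧
    ∀ i : ι, ∃ m : ℤ, C (Function.update (fun _ => 0) i m) = true

/-- `y` is a neighbor of `x`: they differ by `±1` in exactly one coordinate. -/
def IsNeighbor (x y : ι → ℤ) : Prop :=
  ∃ i : ι, y = Function.update x i (x i + 1) ∨ y = Function.update x i (x i - 1)

/-- `k` is the min-width of `C`: the least positive integer such that on every axis
there is a blue point within distance `k` of the origin. -/
def MinWidth (C : (ι → ℤ) → Bool) (k : ℕ) : Prop :=
  IsLeast {w : ℕ | 0 < w ∧ ∀ i : ι, ∃ m : ℤ, |m| ≤ (w : ℤ) ∧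
    C (Function.update (fun _ => 0) i m) = true} k

end Lattice

section Walk

variable {ι G : Type*} [Fintype ι] [AddCommMonoid G]

/-- The sum of `F` over the endpoints of all walks of `N` steps from `x`, where each step adds one
of the vectors `v l`. -/
def walkSum (v : ι → G) (F : G → ℕ) : ℕ → G → ℕ
  | 0, x => F x
  | N + 1, x => ∑ l, walkSum v F N (x + v l)

theorem walkSum_le (v : ι → G) {F : G → ℕ} {s : ℕ} (hF : ∀ x, F x ≤ s) (N : ℕ) (x : G) :
    walkSum v F N x ≤ s * Fintype.card ι ^ N := by
  induction N generalizing x with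
  | zero => simpa [walkSum] using hF x
  | succ N ih =>
    calc walkSum v F (N + 1) x ≤ ∑ _l : ι, s * Fintype.card ι ^ N :=
          Finset.sum_le_sum fun l _ => ih _
      _ = s * Fintype.card ι ^ (N + 1) := by simp [pow_succ]; ring

theorem walkSum_sum {κ : Type*} (t : Finset κ) (v : ι → G) (F : κ → G → ℕ) (N : ℕ) (x : G) :
    walkSum v (fun y => ∑ i ∈ t, F i y) N x = ∑ i ∈ t, walkSum v (F i) N x := by
  induction N generalizing x with
  | zero => rfl
  | succ N ih =>
    simp only [walkSum, ih]
    exact Finset.sum_comm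

/-- If the colors of `x + j • v i` and `x + (j + 1) • v i` differ, then many walks of length `N`
from `x` end at a point whose color changes in direction `v i`. -/
theorem choose_mul_pow_le_walkSum (C : G → Bool) (v : ι → G) {s : ℕ}
    (hs : ∀ x, (Finset.univ.filter fun l => C (x + v l) ≠ C x).card ≤ s) (i : ι) (N j : ℕ) (x : G)
    (hx : C (x + (j + 1) • v i) ≠ C (x + j • v i)) :
    N.choose j * (Fintype.card ι - 2 * s) ^ (N - j) ≤
      walkSum v (fun y => if C (y + v i) ≠ C y then 1 else 0) N x := by
  classical
  induction N generalizing x j with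
  | zero =>
    cases j with
    | zero => simp_all [walkSum]
    | succ j => simp
  | succ N ih =>
    set D := Fintype.card ι - 2 * s with hD
    set W := walkSum v (fun y => if C (y + v i) ≠ C y then 1 else 0) N with hW
    set y := x + j • v i with hy
    have hy' : x + (j + 1) • v i = y + v i := by rw [succ_nsmul, hy, add_assoc]
    rw [hy'] at hx
    set B := (Finset.univ.filter fun l => C (y + v l) ≠ C y) ∪
      (Finset.univ.filter fun l => C (y + v i + v l) ≠ C (y + v i)) with hB
    have hBcard : B.card ≤ 2 * s :=
      (Finset.card_union_le _ _).trans (by have := hs y; have := hs (y + v i); omega)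
    have hgood : D ≤ Bᶜ.card := by rw [Finset.card_compl]; omega
    have hiB : i ∈ B := by simp [hB, hx]
    have hterm : ∀ l ∈ Bᶜ, N.choose j * D ^ (N - j) ≤ W (x + v l) := by
      intro l hl
      refine ih j _ ?_
      simp only [hB, Finset.mem_compl, Finset.mem_union, Finset.mem_filter, Finset.mem_univ,
        true_and, not_or, not_not] at hl
      have h₁ : x + v l + j • v i = y + v l := by rw [hy, add_right_comm]
      have h₂ : x + v l + (j + 1) • v i = y + v i + v l := by rw [add_right_comm, hy']
      rw [h₁, h₂, hl.1, hl.2]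
      exact hx
    have hother : D * (N.choose j * D ^ (N - j)) ≤ ∑ l ∈ Bᶜ, W (x + v l) :=
      calc D * (N.choose j * D ^ (N - j)) ≤ Bᶜ.card * (N.choose j * D ^ (N - j)) :=
            Nat.mul_le_mul_right _ hgood
        _ ≤ ∑ l ∈ Bᶜ, W (x + v l) := by
            simpa using Finset.card_nsmul_le_sum _ _ _ hterm
    have hsplit : W (x + v i) + ∑ l ∈ Bᶜ, W (x + v l) ≤ ∑ l, W (x + v l) := by
      rw [← Finset.sum_add_sum_compl B]
      gcongr
      exact Finset.single_le_sum (f := fun l => W (x + v l)) (fun _ _ => Nat.zero_le _) hiB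
    change _ ≤ ∑ l, W (x + v l)
    refine le_trans ?_ hsplit
    have hstep : N.choose j * D ^ (N + 1 - j) ≤ D * (N.choose j * D ^ (N - j)) := by
      rcases le_or_gt j N with h | h
      · rw [Nat.succ_sub h, pow_succ]
        exact le_of_eq (by ring)
      · simp [Nat.choose_eq_zero_of_lt h]
    cases j with
    | zero =>
      simp only [Nat.choose_zero_right] at hstep hother ⊢
      omega
    | succ j =>
      have hi : N.choose j * D ^ (N - j) ≤ W (x + v i) := by
        refine ih j _ ?_
        rw [add_assoc, add_assoc, ← succ_nsmul', ← succ_nsmul', hy']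
        exact hx
      rw [Nat.choose_succ_succ, add_mul, Nat.add_sub_add_right]
      rw [Nat.add_sub_add_right] at hstep
      exact add_le_add hi (hstep.trans hother)

theorem sum_choose_mul_pow_le (C : G → Bool) (v : ι → G) {s : ℕ}
    (hs : ∀ x, (Finset.univ.filter fun l => C (x + v l) ≠ C x).card ≤ s) (j : ι → ℕ)
    (hj : ∀ i, C ((j i + 1) • v i) ≠ C (j i • v i)) (N : ℕ) :
    ∑ i, N.choose (j i) * (Fintype.card ι - 2 * s) ^ (N - j i) ≤ s * Fintype.card ι ^ N := by
  calc ∑ i, N.choose (j i) * (Fintype.card ι - 2 * s) ^ (N - j i)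
      ≤ ∑ i, walkSum v (fun y => if C (y + v i) ≠ C y then 1 else 0) N 0 :=
        Finset.sum_le_sum fun i _ =>
          choose_mul_pow_le_walkSum C v hs i N (j i) 0 (by simpa using hj i)
    _ = walkSum v (fun y => ∑ i, if C (y + v i) ≠ C y then 1 else 0) N 0 :=
        (walkSum_sum _ _ _ _ _).symm
    _ ≤ s * Fintype.card ι ^ N :=
        walkSum_le v (fun x => by rw [← Finset.card_filter]; exact hs x) N 0

end Walk

theorem pow_le_choose_of_mul_le {M : ℕ} (j N : ℕ) (h : j * M ≤ N) : M ^ j ≤ N.choose j := by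
  induction j generalizing N with
  | zero => simp
  | succ j ih =>
    obtain ⟨N, rfl⟩ : ∃ N', N = N' + M := ⟨N - M, by rw [Nat.sub_add_cancel]; nlinarith⟩
    rw [Nat.add_choose_eq]
    calc M ^ (j + 1) ≤ N.choose j * M.choose 1 := by
          rw [pow_succ, Nat.choose_one_right]
          exact Nat.mul_le_mul_right _ (ih N (by nlinarith))
      _ ≤ _ := Finset.single_le_sum (f := fun ij : ℕ × ℕ => N.choose ij.1 * M.choose ij.2)
          (fun _ _ => Nat.zero_le _) (Finset.HasAntidiagonal.mem_antidiagonal.mpr (rfl : (j, 1).1 + (j, 1).2 = j + 1))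

theorem card_le_exp_mul_pow {ι : Type*} [Fintype ι] {s n : ℕ} (hs : 0 < s) (j : ι → ℕ)
    (hj : ∀ i, j i ≤ n)
    (h : ∀ N : ℕ, ∑ i, N.choose (j i) * (Fintype.card ι - 2 * s) ^ (N - j i) ≤
      s * Fintype.card ι ^ N) :
    (Fintype.card ι : ℝ) ≤ (Real.exp 1 ^ 2 * s) ^ (n + 1) := by
  have he : (2.7 : ℝ) < Real.exp 1 := by linarith [Real.exp_one_gt_d9]
  have he2 : (7 : ℝ) < Real.exp 1 ^ 2 := by nlinarith
  have hs1 : (1 : ℝ) ≤ s := by exact_mod_cast hs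
  set d := Fintype.card ι with hd
  rcases Nat.eq_zero_or_pos n with rfl | hn
  · have h0 := h 0
    have hj0 : ∀ i, j i = 0 := fun i => Nat.le_zero.mp (hj i)
    simp only [hj0] at h0
    have h0' : (d : ℝ) ≤ s := by exact_mod_cast (by simpa using h0 : d ≤ s)
    simp only [zero_add, pow_one]
    nlinarith
  rcases lt_or_ge d (8 * s) with hsmall | hbig
  · have hd8 : (d : ℝ) ≤ 8 * s := by exact_mod_cast hsmall.le
    calc (d : ℝ) ≤ (Real.exp 1 ^ 2 * s) ^ 2 := by
          have h7 : 7 * (s : ℝ) ≤ Real.exp 1 ^ 2 * s := by nlinarith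
          nlinarith
      _ ≤ _ := pow_le_pow_right₀ (by nlinarith) (by omega)
  set D := d - 2 * s with hD
  set M := D / (2 * s) with hM
  have hM3 : 3 ≤ M := (Nat.le_div_iff_mul_le (by omega)).mpr (by omega)
  have hMD : M * (2 * s) ≤ D := Nat.div_mul_le_self _ _
  have hDM : D < 2 * s * (M + 1) := Nat.lt_mul_div_succ D (by omega)
  have hM_le : M ≤ D := Nat.div_le_self _ _
  have hnM : n ≤ n * M := Nat.le_mul_of_pos_right _ (by omega)
  have hterm : ∀ i ∈ Finset.univ, M ^ n * D ^ (n * M - n) ≤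
      (n * M).choose (j i) * D ^ (n * M - j i) := by
    intro i _
    have hji := hj i
    calc M ^ n * D ^ (n * M - n) = M ^ j i * (M ^ (n - j i) * D ^ (n * M - n)) := by
          rw [← mul_assoc, ← pow_add, Nat.add_sub_cancel' hji]
      _ ≤ M ^ j i * (D ^ (n - j i) * D ^ (n * M - n)) := by gcongr
      _ = M ^ j i * D ^ (n * M - j i) := by rw [← pow_add]; congr 2; omega
      _ ≤ _ := Nat.mul_le_mul_right _
          (pow_le_choose_of_mul_le _ _ (Nat.mul_le_mul_right _ hji))
  have hcount : d * (M ^ n * D ^ (n * M - n)) ≤ s * d ^ (n * M) :=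
    le_trans (by simpa [hd] using Finset.card_nsmul_le_sum _ _ _ hterm) (h (n * M))
  have hcount' : d * (M ^ n * D ^ (n * M)) ≤ s * d ^ (n * M) * D ^ n := by
    calc d * (M ^ n * D ^ (n * M)) = d * (M ^ n * D ^ (n * M - n)) * D ^ n := by
          rw [mul_assoc, mul_assoc, ← pow_add, Nat.sub_add_cancel hnM]
      _ ≤ _ := Nat.mul_le_mul_right _ hcount
  have hMR : (3 : ℝ) ≤ M := by exact_mod_cast hM3
  have hDpos : (0 : ℝ) < D := by exact_mod_cast (by omega : 0 < D)
  have hdD : (d : ℝ) = D + 2 * s := by exact_mod_cast (by omega : d = D + 2 * s)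
  have hMDR : (M : ℝ) * (2 * s) ≤ D := by exact_mod_cast hMD
  have hDle : (D : ℝ) ≤ Real.exp 1 * s * M := by
    have h₁ : (D : ℝ) ≤ 2 * s * (M + 1) := by exact_mod_cast hDM.le
    have h₂ : 2.7 * ((s : ℝ) * M) ≤ Real.exp 1 * (s * M) := by gcongr
    nlinarith
  have hpow : (d : ℝ) ^ M ≤ Real.exp 1 * D ^ M := by
    have hd' : (d : ℝ) ≤ Real.exp (2 * s / D) * D := by
      have := Real.add_one_le_exp (2 * s / D : ℝ)
      calc (d : ℝ) = (2 * s / D + 1) * D := by rw [hdD]; field_simp; ring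
        _ ≤ _ := by gcongr
    calc (d : ℝ) ^ M ≤ (Real.exp (2 * s / D) * D) ^ M := by gcongr
      _ = Real.exp (M * (2 * s / D)) * D ^ M := by rw [mul_pow, Real.exp_nat_mul]
      _ ≤ Real.exp 1 * D ^ M := by
          gcongr
          rw [← mul_div_assoc]
          exact (div_le_one hDpos).mpr hMDR
  have hR : (d : ℝ) * (M ^ n * D ^ (n * M)) ≤ s * d ^ (n * M) * D ^ n := by
    exact_mod_cast hcount'
  have hmain : (d : ℝ) * (M ^ n * D ^ (n * M)) ≤
      s * (Real.exp 1 ^ 2 * s) ^ n * (M ^ n * D ^ (n * M)) :=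
    calc (d : ℝ) * (M ^ n * D ^ (n * M)) ≤ s * d ^ (n * M) * D ^ n := hR
      _ = s * (d ^ M) ^ n * D ^ n := by rw [← pow_mul, mul_comm M n]
      _ ≤ s * (Real.exp 1 * D ^ M) ^ n * (Real.exp 1 * s * M) ^ n := by gcongr
      _ = s * (Real.exp 1 ^ 2 * s) ^ n * (M ^ n * D ^ (n * M)) := by
          rw [mul_comm n M, pow_mul]; ring
  have hd_le := le_of_mul_le_mul_right hmain (by positivity)
  calc (d : ℝ) ≤ s * (Real.exp 1 ^ 2 * s) ^ n := hd_le
    _ ≤ (Real.exp 1 ^ 2 * s) * (Real.exp 1 ^ 2 * s) ^ n := by gcongr; nlinarith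
    _ = _ := by ring

section Coloring

variable {ι : Type*} [Fintype ι] [DecidableEq ι]

theorem sensAt_le_sensSup (C : (ι → ℤ) → Bool) (x : ι → ℤ) : sensAt C x ≤ sensSup C := by
  refine le_csSup ⟨Fintype.card (ι × Bool), ?_⟩ ⟨x, rfl⟩
  rintro _ ⟨y, rfl⟩
  exact Finset.card_le_univ _

omit [Fintype ι] in
theorem add_single_eq_update (x : ι → ℤ) (i : ι) (a : ℤ) :
    x + Pi.single i a = Function.update x i (x i + a) := by
  ext l
  rcases eq_or_ne l i with rfl | h <;> simp [*]

theorem card_filter_signed_le_sensAt (C : (ι → ℤ) → Bool) (b : ι → Bool) (x : ι → ℤ) :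
    (Finset.univ.filter fun l =>
      C (x + Pi.single l (if b l then (1 : ℤ) else -1)) ≠ C x).card ≤ sensAt C x := by
  refine Finset.card_le_card_of_injOn (fun l => (l, b l)) ?_ ?_
  · intro l hl
    simpa [add_single_eq_update] using hl
  · intro l _ l' _ h
    exact congrArg Prod.fst h

omit [Fintype ι] in
/-- On an axis with a blue point within distance `n + 1` of the red origin, some direction has a
color change between the distances `j` and `j + 1` with `j ≤ n`. -/
theorem exists_color_change {C : (ι → ℤ) → Bool} (h0 : C (fun _ => 0) = false) {i : ι} {n : ℕ}
    {m : ℤ} (hm : |m| ≤ ((n + 1 : ℕ) : ℤ)) (hC : C (Function.update (fun _ => 0) i m) = true) :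
    ∃ b : Bool, ∃ j ≤ n,
      C ((j + 1) • (Pi.single i (if b then (1 : ℤ) else -1) : ι → ℤ)) ≠
        C (j • (Pi.single i (if b then (1 : ℤ) else -1) : ι → ℤ)) := by
  by_contra! hne
  have hred : ∀ (b : Bool) (j : ℕ), j ≤ n + 1 →
      C (j • (Pi.single i (if b then (1 : ℤ) else -1) : ι → ℤ)) = false := by
    intro b j
    induction j with
    | zero => intro _; rw [zero_nsmul]; exact h0
    | succ j ih => intro hj; rw [hne b j (by omega)]; exact ih (by omega)
  have hmn : m.natAbs ≤ n + 1 := by rw [Int.abs_eq_natAbs] at hm; exact_mod_cast hm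
  have hpoint : Function.update (fun _ => 0) i m =
      m.natAbs • (Pi.single i (if decide (0 ≤ m) then (1 : ℤ) else -1) : ι → ℤ) := by
    ext l
    rcases eq_or_ne l i with rfl | h
    · rcases le_or_gt 0 m with h | h
      · simp [h, abs_of_nonneg]
      · simp [h.not_ge, abs_of_neg h]
    · simp [h]
  rw [hpoint, hred _ _ hmn] at hC
  exact absurd hC (by simp)

end Coloring

/-- For every non-trivial coloring `C` of `ℤ^d` with min-width `k` and
sensitivity `s = s(C)`, one has `s ≥ (1/e²)·d^(1/k)`. -/
theorem sens_lower_bound (d k s : ℕ) (C : (Fin d → ℤ) → Bool)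
    (hC : NontrivialColoring C) (hk : MinWidth C k) (hs : sensSup C = s) :
    (1 / Real.exp 1 ^ 2) * (d : ℝ) ^ ((1 : ℝ) / (k : ℝ)) ≤ (s : ℝ) := by
  obtain ⟨⟨hkpos, hwidth⟩, -⟩ := hk
  obtain ⟨n, rfl⟩ : ∃ n, k = n + 1 := ⟨k - 1, by omega⟩
  have hchange := fun i =>
    let ⟨_, hm, hb⟩ := hwidth i
    exists_color_change hC.1 hm hb
  choose b j hjn hj using hchange
  have hsens : ∀ x, (Finset.univ.filter fun l =>
      C (x + Pi.single l (if b l then (1 : ℤ) else -1)) ≠ C x).card ≤ s := fun x =>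
    (card_filter_signed_le_sensAt C b x).trans (hs ▸ sensAt_le_sensSup C x)
  have hd : (d : ℝ) ≤ (Real.exp 1 ^ 2 * s) ^ (n + 1) := by
    rcases Nat.eq_zero_or_pos d with rfl | hdpos
    · push_cast; positivity
    have hspos : 0 < s := by
      refine lt_of_lt_of_le (Finset.card_pos.mpr ⟨⟨0, hdpos⟩, ?_⟩)
        (hsens (j ⟨0, hdpos⟩ • Pi.single ⟨0, hdpos⟩ (if b ⟨0, hdpos⟩ then (1 : ℤ) else -1)))
      have := hj ⟨0, hdpos⟩
      rw [succ_nsmul] at this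
      simpa only [Finset.mem_filter, Finset.mem_univ, true_and] using this
    simpa using card_le_exp_mul_pow hspos j hjn
      (sum_choose_mul_pow_le C (fun l => Pi.single l (if b l then (1 : ℤ) else -1)) hsens j hj)
  have hroot : (d : ℝ) ^ ((1 : ℝ) / ((n + 1 : ℕ) : ℝ)) ≤ Real.exp 1 ^ 2 * s := by
    rw [one_div]
    calc (d : ℝ) ^ (((n + 1 : ℕ) : ℝ)⁻¹)
        ≤ ((Real.exp 1 ^ 2 * s) ^ (n + 1)) ^ (((n + 1 : ℕ) : ℝ)⁻¹) := by gcongr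
      _ = Real.exp 1 ^ 2 * s := Real.pow_rpow_inv_natCast (by positivity) n.succ_ne_zero
  rw [one_div, inv_mul_le_iff₀ (by positivity)]
  exact hroot
end

section
/- For every repeated coloring C in d = nk dimensions, d ≤ s^R(C) · (2·s^B(C) − 1). -/
open Function

section Repeated

/-- `C` is a repeated coloring in `nk` dimensions built from `C'`: `C'` is a
non-trivial coloring of `ℤ^k` with red sensitivity `1`, and a point `x` is blue
in `C` iff some block `x_i` of `x` is blue in `C'`. -/
def IsRepeatedColoring (n k : ℕ) (C : (Fin n × Fin k → ℤ) → Bool)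
    (C' : (Fin k → ℤ) → Bool) : Prop :=
  NontrivialColoring C' ∧ redSens C' = 1 ∧
    ∀ x : Fin n × Fin k → ℤ, C x = true ↔ ∃ i : Fin n, C' (fun j => x (i, j)) = true

end Repeated

/-- The integer vector `a·e_i`. -/
def axisVec {ι : Type*} [DecidableEq ι] (i : ι) (a : ℤ) : ι → ℤ := Pi.single i a

section AxisVec

variable {ι : Type*} [DecidableEq ι]

lemma axisVec_apply (i j : ι) (a : ℤ) : axisVec i a j = if j = i then a else 0 :=
  Pi.single_apply i a j

@[simp] lemma axisVec_zero (i : ι) : axisVec i 0 = 0 := Pi.single_zero i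

lemma axisVec_add (i : ι) (a b : ℤ) : axisVec i (a + b) = axisVec i a + axisVec i b :=
  Pi.single_add (f := fun _ : ι => ℤ) i a b

lemma axisVec_neg (i : ι) (a : ℤ) : axisVec i (-a) = -axisVec i a :=
  Pi.single_neg (f := fun _ : ι => ℤ) i a

lemma update_add_eq_add_axisVec (x : ι → ℤ) (i : ι) (a : ℤ) :
    Function.update x i (x i + a) = x + axisVec i a := by
  ext j
  by_cases hj : j = i
  · subst hj; simp [axisVec_apply]
  · simp [hj, axisVec_apply]

/-- The coordinate direction `i` is sensitive for `C` at `x`. -/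
def IsSensitiveDir (C : (ι → ℤ) → Bool) (x : ι → ℤ) (i : ι) : Prop :=
  ∃ a : ℤ, (a = 1 ∨ a = -1) ∧ C (x + axisVec i a) ≠ C x

lemma isSensitiveDir_iff (C : (ι → ℤ) → Bool) (x : ι → ℤ) (i : ι) :
    IsSensitiveDir C x i ↔ C (Function.update x i (x i + 1)) ≠ C x ∨
      C (Function.update x i (x i - 1)) ≠ C x := by
  rw [sub_eq_add_neg, update_add_eq_add_axisVec, update_add_eq_add_axisVec]
  constructor
  · rintro ⟨a, rfl | rfl, ha⟩
    exacts [Or.inl ha, Or.inr ha]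
  · rintro (h | h)
    exacts [⟨1, Or.inl rfl, h⟩, ⟨-1, Or.inr rfl, h⟩]

end AxisVec

section SensitivityBounds

variable {ι : Type*} [Fintype ι] [DecidableEq ι]

lemma axisSensAt_le_card (C : (ι → ℤ) → Bool) (x : ι → ℤ) :
    axisSensAt C x ≤ Fintype.card ι :=
  Finset.card_le_univ _

lemma bddAbove_axisSensAt_image (C : (ι → ℤ) → Bool) (s : Set (ι → ℤ)) :
    BddAbove (axisSensAt C '' s) := by
  refine ⟨Fintype.card ι, ?_⟩
  rintro _ ⟨x, -, rfl⟩
  exact axisSensAt_le_card C x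

lemma axisSensAt_le_redSens {C : (ι → ℤ) → Bool} {x : ι → ℤ} (hx : C x = false) :
    axisSensAt C x ≤ redSens C :=
  le_csSup (bddAbove_axisSensAt_image C _) ⟨x, hx, rfl⟩

lemma axisSensAt_le_blueSens {C : (ι → ℤ) → Bool} {x : ι → ℤ} (hx : C x = true) :
    axisSensAt C x ≤ blueSens C :=
  le_csSup (bddAbove_axisSensAt_image C _) ⟨x, hx, rfl⟩

lemma exists_axisSensAt_eq_redSens {C : (ι → ℤ) → Bool} {x : ι → ℤ} (hx : C x = false) :
    ∃ y, C y = false ∧ axisSensAt C y = redSens C :=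
  Nat.sSup_mem (s := axisSensAt C '' {x | C x = false}) ⟨_, x, hx, rfl⟩
    (bddAbove_axisSensAt_image C _)

lemma card_le_axisSensAt {C : (ι → ℤ) → Bool} {x : ι → ℤ} {S : Finset ι}
    (hS : ∀ i ∈ S, IsSensitiveDir C x i) : S.card ≤ axisSensAt C x :=
  Finset.card_le_card fun i hi => by
    simpa using (isSensitiveDir_iff C x i).1 (hS i hi)

lemma exists_finset_card_eq_axisSensAt (C : (ι → ℤ) → Bool) (x : ι → ℤ) :
    ∃ S : Finset ι, S.card = axisSensAt C x ∧ ∀ i ∈ S, IsSensitiveDir C x i :=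
  ⟨_, rfl, fun i hi => (isSensitiveDir_iff C x i).2 (Finset.mem_filter.1 hi).2⟩

end SensitivityBounds

section RedSensitivityOne

variable {ι : Type*} [DecidableEq ι]

/-- Every red point has at most one sensitive direction. -/
def RedSensLeOne (C : (ι → ℤ) → Bool) : Prop :=
  ∀ (x : ι → ℤ) (i j : ι) (a b : ℤ), i ≠ j → (a = 1 ∨ a = -1) → (b = 1 ∨ b = -1) →
    C (x + axisVec i a) = true → C (x + axisVec j b) = true → C x = true

lemma redSensLeOne_of_redSens_le [Fintype ι] {C : (ι → ℤ) → Bool} (h : redSens C ≤ 1) :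
    RedSensLeOne C := by
  intro x i j a b hij ha hb hxi hxj
  by_contra hx
  rw [Bool.not_eq_true] at hx
  have hcard : ({i, j} : Finset ι).card ≤ axisSensAt C x := by
    apply card_le_axisSensAt
    intro l hl
    rcases Finset.mem_insert.1 hl with rfl | hl
    · exact ⟨a, ha, by simp [hxi, hx]⟩
    · rw [Finset.mem_singleton.1 hl]
      exact ⟨b, hb, by simp [hxj, hx]⟩
  rw [Finset.card_pair hij] at hcard
  have := axisSensAt_le_redSens hx
  omega

/-- The line through `x` in direction `i` contains a red point. -/
def HasRedOnLine (C : (ι → ℤ) → Bool) (x : ι → ℤ) (i : ι) : Prop :=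
  ∃ t : ℤ, C (x + axisVec i t) = false

lemma hasRedOnLine_add_axisVec_self {C : (ι → ℤ) → Bool} {x : ι → ℤ} {i : ι} {a : ℤ} :
    HasRedOnLine C (x + axisVec i a) i ↔ HasRedOnLine C x i := by
  constructor
  · rintro ⟨t, ht⟩
    exact ⟨a + t, by rwa [axisVec_add, ← add_assoc]⟩
  · rintro ⟨t, ht⟩
    exact ⟨-a + t, by rwa [add_assoc, ← axisVec_add, add_neg_cancel_left]⟩

lemma RedSensLeOne.fill {C : (ι → ℤ) → Bool} (hC : RedSensLeOne C) {x : ι → ℤ} {i j : ι}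
    {a b : ℤ} (hij : i ≠ j) (ha : a = 1 ∨ a = -1) (hb : b = 1 ∨ b = -1)
    (hi : C (x + axisVec i a) = true) (hj : C (x + axisVec j b) = true) :
    C (x + axisVec i a + axisVec j b) = true := by
  refine hC _ i j (-a) (-b) hij (by omega) (by omega) ?_ ?_
  · rw [axisVec_neg, add_right_comm, add_neg_cancel_right]
    exact hj
  · rw [axisVec_neg, add_neg_cancel_right]
    exact hi

lemma RedSensLeOne.hasRedOnLine_of_step {C : (ι → ℤ) → Bool} (hC : RedSensLeOne C)
    {x : ι → ℤ} {i j : ι} {a : ℤ} (ha : a = 1 ∨ a = -1)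
    (hxa : C (x + axisVec i a) = true) (h : HasRedOnLine C (x + axisVec i a) j) :
    HasRedOnLine C x j := by
  by_cases hij : i = j
  · subst hij
    exact hasRedOnLine_add_axisVec_self.1 h
  by_contra hno
  have hline : ∀ t : ℤ, C (x + axisVec j t) = true := fun t => by
    by_contra ht
    exact hno ⟨t, by simpa using ht⟩
  have hstep : ∀ t b : ℤ, (b = 1 ∨ b = -1) → C (x + axisVec i a + axisVec j t) = true →
      C (x + axisVec i a + axisVec j (t + b)) = true := by
    intro t b hb ht
    have := hC.fill (x := x + axisVec j t) hij ha hb (by rwa [add_right_comm])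
      (by rw [add_assoc, ← axisVec_add]; exact hline _)
    rwa [add_right_comm x, add_assoc (x + axisVec i a), ← axisVec_add] at this
  obtain ⟨t, ht⟩ := h
  have hblue : C (x + axisVec i a + axisVec j t) = true := by
    induction t using Int.induction_on with
    | zero => simpa using hxa
    | succ n ih => exact hstep _ 1 (Or.inl rfl) (by by_contra hn; simp_all)
    | pred n ih => exact hstep _ (-1) (Or.inr rfl) (by by_contra hn; simp_all)
  simp [hblue] at ht

lemma RedSensLeOne.hasRedOnLine_of_step_symm {C : (ι → ℤ) → Bool} (hC : RedSensLeOne C)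
    {x : ι → ℤ} {i j : ι} {a : ℤ} (ha : a = 1 ∨ a = -1)
    (hx : C x = true) (h : HasRedOnLine C x j) : HasRedOnLine C (x + axisVec i a) j := by
  have hback : x + axisVec i a + axisVec i (-a) = x := by
    rw [axisVec_neg, add_neg_cancel_right]
  exact hC.hasRedOnLine_of_step (i := i) (a := -a) (by omega) (by rwa [hback]) (by rwa [hback])

lemma RedSensLeOne.hasRedOnLine_of_blue_line {C : (ι → ℤ) → Bool} (hC : RedSensLeOne C)
    {x : ι → ℤ} {i j : ι} (hline : ¬ HasRedOnLine C x i) (t : ℤ)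
    (h : HasRedOnLine C (x + axisVec i t) j) : HasRedOnLine C x j := by
  have hblue : ∀ s : ℤ, C (x + axisVec i s) = true := fun s => by
    by_contra hs
    exact hline ⟨s, by simpa using hs⟩
  induction t using Int.induction_on with
  | zero => simpa using h
  | succ n ih =>
    have hs := hblue (n + 1)
    rw [axisVec_add, ← add_assoc] at h hs
    exact ih (hC.hasRedOnLine_of_step (Or.inl rfl) hs h)
  | pred n ih =>
    have hs := hblue (-n - 1)
    rw [sub_eq_add_neg, axisVec_add, ← add_assoc] at h hs
    exact ih (hC.hasRedOnLine_of_step (Or.inr rfl) hs h)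

lemma RedSensLeOne.isSensitiveDir_of_step {C : (ι → ℤ) → Bool} (hC : RedSensLeOne C)
    {x : ι → ℤ} {i j : ι} {a : ℤ} (hij : i ≠ j) (ha : a = 1 ∨ a = -1) (hx : C x = true)
    (hxa : C (x + axisVec i a) = true) (h : IsSensitiveDir C x j) :
    IsSensitiveDir C (x + axisVec i a) j := by
  obtain ⟨b, hb, hxb⟩ := h
  refine ⟨b, hb, fun hne => hxb ?_⟩
  rw [hxa] at hne
  have hback : x + axisVec i a + axisVec i (-a) = x := by
    rw [axisVec_neg, add_neg_cancel_right]
  have := hC.fill (x := x + axisVec i a) (a := -a) hij (by omega) hb (by rwa [hback]) hne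
  rw [hback] at this
  rw [this, hx]

lemma RedSensLeOne.exists_sensitive_insert {C : (ι → ℤ) → Bool} (hC : RedSensLeOne C)
    {G T : Finset ι} {j : ι} {a : ℤ} (ha : a = 1 ∨ a = -1) (n : ℕ) :
    ∀ x : ι → ℤ, C x = true → C (x + axisVec j (n * a)) = false →
      (∀ i ∈ G, HasRedOnLine C x i) → (∀ i ∈ T, IsSensitiveDir C x i) →
      ∃ y, C y = true ∧ (∀ i ∈ G, HasRedOnLine C y i) ∧
        ∀ i ∈ insert j T, IsSensitiveDir C y i := by
  induction n with
  | zero =>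
    intro x hx hred
    simp [hx] at hred
  | succ n ih =>
    intro x hx hred hG hT
    by_cases hj : IsSensitiveDir C x j
    · exact ⟨x, hx, hG, Finset.forall_mem_insert _ _ _ |>.2 ⟨hj, hT⟩⟩
    have hxa : C (x + axisVec j a) = true := by
      by_contra hne
      exact hj ⟨a, ha, by rwa [hx]⟩
    refine ih (x + axisVec j a) hxa ?_ (fun i hi => hC.hasRedOnLine_of_step_symm ha hx (hG i hi))
      fun i hi => hC.isSensitiveDir_of_step ?_ ha hx hxa (hT i hi)
    · rw [add_assoc, ← axisVec_add]
      rwa [Nat.cast_succ, add_mul, one_mul, add_comm (_ * a)] at hred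
    · rintro rfl
      exact hj (hT _ hi)

lemma RedSensLeOne.exists_sensitive {C : (ι → ℤ) → Bool} (hC : RedSensLeOne C)
    {G : Finset ι} {x : ι → ℤ} (hx : C x = true) (hG : ∀ i ∈ G, HasRedOnLine C x i) :
    ∃ y, C y = true ∧ ∀ i ∈ G, IsSensitiveDir C y i := by
  suffices h : ∀ T ⊆ G, ∃ y, C y = true ∧ (∀ i ∈ G, HasRedOnLine C y i) ∧
      ∀ i ∈ T, IsSensitiveDir C y i by
    obtain ⟨y, hy, -, hT⟩ := h G subset_rfl
    exact ⟨y, hy, hT⟩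
  intro T
  induction T using Finset.induction_on with
  | empty => exact fun _ => ⟨x, hx, hG, by simp⟩
  | insert j T _ ih =>
    intro hjT
    obtain ⟨y, hy, hyG, hyT⟩ := ih ((Finset.subset_insert j T).trans hjT)
    obtain ⟨t, ht⟩ := hyG j (hjT (Finset.mem_insert_self j T))
    rcases Int.eq_nat_or_neg t with ⟨n, rfl | rfl⟩
    · exact hC.exists_sensitive_insert (Or.inl rfl) n y hy (by simpa using ht) hyG hyT
    · exact hC.exists_sensitive_insert (Or.inr rfl) n y hy (by simpa using ht) hyG hyT

lemma RedSensLeOne.hasRedOnLine_or {C : (ι → ℤ) → Bool} (hC : RedSensLeOne C)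
    {x : ι → ℤ} {i j : ι} {s t : ℤ} (hx : C x = false) :
    HasRedOnLine C (x + axisVec i s) j ∨ HasRedOnLine C (x + axisVec j t) i := by
  by_contra! h
  obtain ⟨hj, hi⟩ := h
  have hback : x + axisVec j t + axisVec i s + axisVec i (-s) = x + axisVec j t := by
    rw [axisVec_neg, add_neg_cancel_right]
  have hcorner : HasRedOnLine C (x + axisVec j t + axisVec i s) j := by
    refine hC.hasRedOnLine_of_blue_line (i := i) (mt hasRedOnLine_add_axisVec_self.1 hi) (-s) ?_
    rw [hback]
    exact hasRedOnLine_add_axisVec_self.2 ⟨0, by simpa using hx⟩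
  rw [add_right_comm] at hcorner
  exact hj (hasRedOnLine_add_axisVec_self.1 hcorner)

end RedSensitivityOne

section Dimension

/-- In a reflexive relation in which any two elements are comparable, some element is related
to more than half of all elements. -/
lemma exists_card_lt_two_mul_card_filter {ι : Type*} [Fintype ι] [Nonempty ι]
    (r : ι → ι → Prop) [DecidableRel r] (hrefl : ∀ i, r i i) (htotal : ∀ i j, r i j ∨ r j i) :
    ∃ i, Fintype.card ι < 2 * (Finset.univ.filter fun j => r i j).card := by
  classical
  by_contra! h
  have hpair : ∀ i j, 1 + (if i = j then 1 else 0) ≤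
      (if r i j then 1 else 0) + (if r j i then 1 else 0) := by
    intro i j
    by_cases hij : i = j
    · subst hij
      simp [hrefl]
    · rcases htotal i j with hr | hr <;> simp [hij, hr]
  have hsum := Finset.sum_le_sum fun i (_ : i ∈ Finset.univ) =>
    Finset.sum_le_sum fun j (_ : j ∈ Finset.univ) => hpair i j
  simp only [Finset.sum_add_distrib] at hsum
  rw [Finset.sum_comm (f := fun i j => if r j i then 1 else 0)] at hsum
  simp only [← Finset.card_filter] at hsum
  have hle := Finset.sum_le_sum fun i (_ : i ∈ Finset.univ) => h i
  rw [← Finset.mul_sum] at hle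
  have hpos : 0 < Fintype.card ι := Fintype.card_pos
  simp [Finset.filter_eq] at hsum hle
  omega

/-- A non-trivial coloring of `ℤ^ι` with red sensitivity at most one satisfies
`|ι| ≤ 2·s^B(C) - 1`. -/
lemma NontrivialColoring.card_lt_two_mul_blueSens {ι : Type*} [Fintype ι] [DecidableEq ι]
    [Nonempty ι] {C : (ι → ℤ) → Bool} (h : NontrivialColoring C) (hred : redSens C ≤ 1) :
    Fintype.card ι < 2 * blueSens C := by
  classical
  obtain ⟨h0, haxis⟩ := h
  have hC := redSensLeOne_of_redSens_le hred
  choose m hm using haxis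
  have hm' : ∀ i, C (0 + axisVec i (m i)) = true := fun i => by
    rw [zero_add]
    convert hm i using 2
    ext j
    by_cases hj : j = i
    · subst hj; simp [axisVec_apply]
    · simp [hj, axisVec_apply]
  obtain ⟨i, hi⟩ := exists_card_lt_two_mul_card_filter
    (fun i j => HasRedOnLine C (0 + axisVec i (m i)) j)
    (fun i => hasRedOnLine_add_axisVec_self.2 ⟨0, by rwa [axisVec_zero, add_zero]⟩)
    (fun i j => hC.hasRedOnLine_or h0)
  obtain ⟨y, hy, hsens⟩ := hC.exists_sensitive (hm' i)
    (G := Finset.univ.filter fun j => HasRedOnLine C (0 + axisVec i (m i)) j)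
    fun j hj => (Finset.mem_filter.1 hj).2
  have h1 := card_le_axisSensAt hsens
  have h2 := axisSensAt_le_blueSens hy
  omega

end Dimension

section RepeatedSensitivity

variable {n k : ℕ} {C : (Fin n × Fin k → ℤ) → Bool} {C' : (Fin k → ℤ) → Bool}

lemma block_add_axisVec (x : Fin n × Fin k → ℤ) (i : Fin n) (j : Fin k) (a : ℤ) :
    (fun l => (x + axisVec (i, j) a : Fin n × Fin k → ℤ) (i, l)) =
      (fun l => x (i, l)) + axisVec j a := by
  ext l
  by_cases hl : l = j
  · subst hl; simp [axisVec_apply]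
  · simp [hl, axisVec_apply]

lemma block_add_axisVec_of_ne (x : Fin n × Fin k → ℤ) {i i' : Fin n} (hi : i' ≠ i) (j : Fin k)
    (a : ℤ) : (fun l => (x + axisVec (i, j) a : Fin n × Fin k → ℤ) (i', l)) =
      fun l => x (i', l) := by
  ext l
  simp [hi, axisVec_apply]

/-- If all blocks of `x` other than the `i`-th are red, then near the `i`-th block the repeated
coloring agrees with the original one. -/
lemma IsRepeatedColoring.isSensitiveDir (h : IsRepeatedColoring n k C C')
    {x : Fin n × Fin k → ℤ} {i : Fin n} (hx : ∀ i' ≠ i, C' (fun l => x (i', l)) = false)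
    {j : Fin k} (hj : IsSensitiveDir C' (fun l => x (i, l)) j) : IsSensitiveDir C x (i, j) := by
  obtain ⟨-, -, hC⟩ := h
  have key : ∀ z : Fin n × Fin k → ℤ, (∀ i' ≠ i, C' (fun l => z (i', l)) = false) →
      C z = C' (fun l => z (i, l)) := by
    intro z hz
    rw [Bool.eq_iff_iff, hC]
    refine ⟨?_, fun hzi => ⟨i, hzi⟩⟩
    rintro ⟨i', hi'⟩
    by_cases hii : i' = i
    · rwa [hii] at hi'
    · simp [hz i' hii] at hi'
  obtain ⟨a, ha, hne⟩ := hj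
  refine ⟨a, ha, ?_⟩
  rw [key x hx, key (x + axisVec (i, j) a), block_add_axisVec]
  · exact hne
  · intro i' hi'
    rw [block_add_axisVec_of_ne x hi']
    exact hx i' hi'

lemma IsRepeatedColoring.le_redSens (h : IsRepeatedColoring n k C C') : n ≤ redSens C := by
  obtain ⟨x, hx, hsens⟩ := exists_axisSensAt_eq_redSens h.1.1
  rw [h.2.1] at hsens
  obtain ⟨S, hcard, hS⟩ := exists_finset_card_eq_axisSensAt C' x
  obtain ⟨j, hj⟩ := Finset.card_pos.1 (by omega : 0 < S.card)
  have hred : C (fun p => x p.2) = false := by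
    rw [← Bool.not_eq_true, h.2.2]
    simp [hx]
  refine le_trans ?_ (axisSensAt_le_redSens hred)
  have hle := card_le_axisSensAt (C := C) (x := fun p => x p.2)
    (S := Finset.univ.image fun i : Fin n => (i, j)) (by
      intro p hp
      obtain ⟨i, -, rfl⟩ := Finset.mem_image.1 hp
      exact h.isSensitiveDir (fun _ _ => hx) (hS j hj))
  rwa [Finset.card_image_of_injective _ fun _ _ hab => (Prod.ext_iff.1 hab).1, Finset.card_univ,
    Fintype.card_fin] at hle

lemma IsRepeatedColoring.blueSens_le (h : IsRepeatedColoring n k C C') (i : Fin n) :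
    blueSens C' ≤ blueSens C := by
  refine csSup_le' ?_
  rintro _ ⟨y, hy, rfl⟩
  set x : Fin n × Fin k → ℤ := fun p => if p.1 = i then y p.2 else 0 with hxdef
  have hxi : (fun l => x (i, l)) = y := by simp [hxdef]
  have hxi' : ∀ i' ≠ i, C' (fun l => x (i', l)) = false := by
    intro i' hi'
    simpa [hxdef, hi'] using h.1.1
  have hblue : C x = true := (h.2.2 x).2 ⟨i, by rw [hxi]; exact hy⟩
  obtain ⟨S, hcard, hS⟩ := exists_finset_card_eq_axisSensAt C' y
  have hle := card_le_axisSensAt (C := C) (x := x) (S := S.image fun j => (i, j)) (by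
    intro p hp
    obtain ⟨j, hj, rfl⟩ := Finset.mem_image.1 hp
    exact h.isSensitiveDir hxi' (by rw [hxi]; exact hS j hj))
  rw [Finset.card_image_of_injective _ fun _ _ hab => (Prod.ext_iff.1 hab).2, hcard] at hle
  exact hle.trans (axisSensAt_le_blueSens hblue)

end RepeatedSensitivity

/-- For every repeated coloring `C` in `d = nk` dimensions,
`d ≤ s^R(C)·(2·s^B(C) - 1)`. -/
theorem repeated_dimension_bound (n k : ℕ) (C : (Fin n × Fin k → ℤ) → Bool)
    (C' : (Fin k → ℤ) → Bool) (h : IsRepeatedColoring n k C C') :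
    n * k ≤ redSens C * (2 * blueSens C - 1) := by
  rcases Nat.eq_zero_or_pos n with rfl | hn
  · simp
  rcases Nat.eq_zero_or_pos k with rfl | hk
  · simp
  have : Nonempty (Fin k) := ⟨⟨0, hk⟩⟩
  have hlt := h.1.card_lt_two_mul_blueSens h.2.1.le
  rw [Fintype.card_fin] at hlt
  have hle := h.blueSens_le ⟨0, hn⟩
  exact Nat.mul_le_mul h.le_redSens (by omega)
end
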